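/- Let A=(P,T_A,Pre_A,Post_A) and B=(P,T_B,Pre_B,Post_B) be Petri nets over the same finite set P of places (with T_A, T_B disjoint), with initial markings M₀(A) and M₀(B), and let ℓ_A : T_A → Σ_A∪{ε} and ℓ_B : T_B → Σ_B∪{ε} be any labeling functions. Construct the labeled Petri net system G with places P ∪ {p₁,p₂,p₃} (three fresh places), transitions T_A ∪ T_B ∪ {t₁,t₂} ∪ {s_x : x ∈ Σ_A}, and arcs: t₁ consumes one token from p₃ and produces the marking M₀(A) on P and one token in p₁; t₂ consumes one token from p₃ and produces M₀(B) on P and one token in p₂; every t ∈ T_A keeps its arcs on P and additionally has a self-loop on p₁ (Pre=Post=1 on p₁); every t ∈ T_B keeps its arcs on P and additionally has a self-loop on p₂; every s_x has a self-loop on p₂ and no other arcs. The labeling of G is ℓ(t)=ℓ_A(t) for t∈T_A, ℓ(t)=ℓ_B(t) for t∈T_B, ℓ(t₁)=ℓ(t₂)=ε, and ℓ(s_x)=x for each x ∈ Σ_A. The initial marking of G has one token in p₃ and zero tokens elsewhere. Let the critical set be C = {0_P×(0,0,1)} ∪ {M×(1,0,0) : M ∈ R(B)} ∪ {M×(0,1,0)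 : M ∈ R(B)}, where M×(i,j,k) denotes the marking of G agreeing with M on P and putting i, j, k tokens in p₁, p₂, p₃ respectively, 0_P is the zero marking on P, and R(B) is the set of markings of B reachable from M₀(B). Then R(A) ⊆ R(B) if and only if G is critically observable with respect to C. -/

import Mathlib

/-- Transition t is enabled at marking M. -/
def enabled {P T : Type*} (Pre : P → T → ℕ) (M : P → ℕ) (t : T) : Prop :=
  ∀ p, Pre p t ≤ M p

/-- Firing transition t at marking M. -/
def fire {P T : Type*} (Pre Post : P → T → ℕ) (M : P → ℕ) (t : T) : P → ℕ :=
  fun p => M p - Pre p t + Post p t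

/-- M →σ M': the transition sequence σ is enabled at M and its firing yields M'. -/
def fires {P T : Type*} (Pre Post : P → T → ℕ) : (P → ℕ) → List T → (P → ℕ) → Prop
  | M, [], M' => M' = M
  | M, t :: σ, M' => enabled Pre M t ∧ fires Pre Post (fire Pre Post M t) σ M'

/-- The reachability set R(G): all markings reachable from M0. -/
def RG {P T : Type*} (Pre Post : P → T → ℕ) (M0 : P → ℕ) : Set (P → ℕ) :=
  {M | ∃ σ : List T, fires Pre Post M0 σ M}

/-- R(G,w): all markings reachable from M0 by a firing sequence with observation w,
where the labeling `lab : T → Option A` sends unobservable transitions to `none`. -/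
def RGs {P T A : Type*} (Pre Post : P → T → ℕ) (M0 : P → ℕ) (lab : T → Option A)
    (w : List A) : Set (P → ℕ) :=
  {M | ∃ σ : List T, σ.filterMap lab = w ∧ fires Pre Post M0 σ M}

/-- Critical observability of a labeled Petri net system w.r.t. a set C of critical
markings: for every observation w, either R(G,w) ⊆ C or R(G,w) ⊆ R(G)∖C. -/
def CritObsPN {P T A : Type*} (Pre Post : P → T → ℕ) (M0 : P → ℕ) (lab : T → Option A)
    (C : Set (P → ℕ)) : Prop :=
  ∀ w : List A, RGs Pre Post M0 lab w ⊆ C ∨ RGs Pre Post M0 lab w ⊆ RG Pre Post M0 \ C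

/- The net G of the undecidability reduction.  Places are `P ⊕ Fin 3` where `Sum.inr 0`,
`Sum.inr 1`, `Sum.inr 2` are the fresh places p₁, p₂, p₃.  Transitions are
`TA ⊕ TB ⊕ Bool ⊕ SA` where `Sum.inl t` are the transitions of A, `Sum.inr (Sum.inl t)`
the transitions of B, `Sum.inr (Sum.inr (Sum.inl true))` is t₁,
`Sum.inr (Sum.inr (Sum.inl false))` is t₂, and `Sum.inr (Sum.inr (Sum.inr x))` is s_x. -/

/-- Pre-incidence of G: t₁ and t₂ consume a token from p₃; transitions of A (resp. B)
keep their pre-arcs on P and have a self-loop on p₁ (resp. p₂); s_x has a self-loop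
on p₂. -/
def inclPre {P TA TB SA : Type*} (PreA : P → TA → ℕ) (PreB : P → TB → ℕ) :
    (P ⊕ Fin 3) → (TA ⊕ TB ⊕ Bool ⊕ SA) → ℕ
  | Sum.inl p, Sum.inl t => PreA p t
  | Sum.inr j, Sum.inl _ => if j = 0 then 1 else 0
  | Sum.inl p, Sum.inr (Sum.inl t) => PreB p t
  | Sum.inr j, Sum.inr (Sum.inl _) => if j = 1 then 1 else 0
  | Sum.inl _, Sum.inr (Sum.inr (Sum.inl _)) => 0
  | Sum.inr j, Sum.inr (Sum.inr (Sum.inl _)) => if j = 2 then 1 else 0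
  | Sum.inl _, Sum.inr (Sum.inr (Sum.inr _)) => 0
  | Sum.inr j, Sum.inr (Sum.inr (Sum.inr _)) => if j = 1 then 1 else 0

/-- Post-incidence of G: t₁ produces M₀(A) on P and a token in p₁; t₂ produces M₀(B) on
P and a token in p₂; transitions of A (resp. B) keep their post-arcs on P and have a
self-loop on p₁ (resp. p₂); s_x has a self-loop on p₂. -/
def inclPost {P TA TB SA : Type*} (PostA : P → TA → ℕ) (PostB : P → TB → ℕ)
    (M0A M0B : P → ℕ) : (P ⊕ Fin 3) → (TA ⊕ TB ⊕ Bool ⊕ SA) → ℕ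
  | Sum.inl p, Sum.inl t => PostA p t
  | Sum.inr j, Sum.inl _ => if j = 0 then 1 else 0
  | Sum.inl p, Sum.inr (Sum.inl t) => PostB p t
  | Sum.inr j, Sum.inr (Sum.inl _) => if j = 1 then 1 else 0
  | Sum.inl p, Sum.inr (Sum.inr (Sum.inl b)) => if b then M0A p else M0B p
  | Sum.inr j, Sum.inr (Sum.inr (Sum.inl b)) =>
      if b then (if j = 0 then 1 else 0) else (if j = 1 then 1 else 0)
  | Sum.inl _, Sum.inr (Sum.inr (Sum.inr _)) => 0
  | Sum.inr j, Sum.inr (Sum.inr (Sum.inr _)) => if j = 1 then 1 else 0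

/-- Labeling of G over Σ_A ∪ Σ_B = `SA ⊕ SB`: transitions of A and B keep their labels,
t₁ and t₂ are unobservable, and s_x is labeled by x ∈ Σ_A. -/
def inclLab {TA TB SA SB : Type*} (lA : TA → Option SA) (lB : TB → Option SB) :
    (TA ⊕ TB ⊕ Bool ⊕ SA) → Option (SA ⊕ SB)
  | Sum.inl t => (lA t).map Sum.inl
  | Sum.inr (Sum.inl t) => (lB t).map Sum.inr
  | Sum.inr (Sum.inr (Sum.inl _)) => none
  | Sum.inr (Sum.inr (Sum.inr x)) => some (Sum.inl x)

/-- The marking M×(i,j,k) of G: agrees with M on P and puts i, j, k tokens in p₁, p₂, p₃. -/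
def extMark {P : Type*} (M : P → ℕ) (i j k : ℕ) : P ⊕ Fin 3 → ℕ :=
  Sum.elim M (fun x => if x = 0 then i else if x = 1 then j else k)

theorem fires_append {P T : Type*} {Pre Post : P → T → ℕ} {M M' M'' : P → ℕ} {σ τ : List T}
    (h : fires Pre Post M σ M') (h' : fires Pre Post M' τ M'') :
    fires Pre Post M (σ ++ τ) M'' := by
  induction σ generalizing M with
  | nil => cases h; exact h'
  | cons t σ ih => exact ⟨h.1, ih h.2⟩

theorem fire_mem_RG {P T : Type*} {Pre Post : P → T → ℕ} {M₀ M : P → ℕ} {t : T}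
    (h : M ∈ RG Pre Post M₀) (ht : enabled Pre M t) : fire Pre Post M t ∈ RG Pre Post M₀ := by
  obtain ⟨σ, hσ⟩ := h
  exact ⟨σ ++ [t], fires_append hσ ⟨ht, rfl⟩⟩

/-- A set of markings that contains the start and is closed under firing contains the end of
every firing sequence. -/
theorem fires_induction {P T : Type*} {Pre Post : P → T → ℕ} {S : Set (P → ℕ)}
    (hS : ∀ M ∈ S, ∀ t, enabled Pre M t → fire Pre Post M t ∈ S) {M M' : P → ℕ} {σ : List T}
    (hM : M ∈ S) (h : fires Pre Post M σ M') : M' ∈ S := by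
  induction σ generalizing M with
  | nil => cases h; exact hM
  | cons t σ ih => exact ih (hS M hM t h.1) h.2

section inclusionNet

variable {P TA TB SA SB : Type*} {PreA PostA : P → TA → ℕ} {PreB PostB : P → TB → ℕ}
  {M0A M0B : P → ℕ}

theorem extMark_inj {M M' : P → ℕ} {i j k i' j' k' : ℕ} :
    extMark M i j k = extMark M' i' j' k' ↔ M = M' ∧ i = i' ∧ j = j' ∧ k = k' := by
  refine ⟨fun h => ⟨funext fun p => congrFun h (Sum.inl p), ?_, ?_, ?_⟩, ?_⟩
  · simpa [extMark] using congrFun h (Sum.inr 0)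
  · simpa [extMark] using congrFun h (Sum.inr 1)
  · simpa [extMark] using congrFun h (Sum.inr 2)
  · rintro ⟨rfl, rfl, rfl, rfl⟩
    rfl

theorem enabled_inl_iff {M : P → ℕ} {i j k : ℕ} {t : TA} :
    enabled (inclPre (SA := SA) PreA PreB) (extMark M i j k) (Sum.inl t) ↔
      enabled PreA M t ∧ 1 ≤ i := by
  simp [enabled, Sum.forall, inclPre, extMark, Fin.forall_fin_succ]

theorem enabled_inr_inl_iff {M : P → ℕ} {i j k : ℕ} {t : TB} :
    enabled (inclPre (SA := SA) PreA PreB) (extMark M i j k) (Sum.inr (Sum.inl t)) ↔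
      enabled PreB M t ∧ 1 ≤ j := by
  simp [enabled, Sum.forall, inclPre, extMark, Fin.forall_fin_succ]

theorem enabled_start_iff {M : P → ℕ} {i j k : ℕ} {b : Bool} :
    enabled (inclPre (SA := SA) PreA PreB) (extMark M i j k)
      (Sum.inr (Sum.inr (Sum.inl b))) ↔ 1 ≤ k := by
  simp [enabled, Sum.forall, inclPre, extMark, Fin.forall_fin_succ]

theorem enabled_letter_iff {M : P → ℕ} {i j k : ℕ} {x : SA} :
    enabled (inclPre PreA PreB) (extMark M i j k)
      (Sum.inr (Sum.inr (Sum.inr x))) ↔ 1 ≤ j := by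
  simp [enabled, Sum.forall, inclPre, extMark, Fin.forall_fin_succ]

theorem fire_inl {M : P → ℕ} {t : TA} :
    fire (inclPre (SA := SA) PreA PreB) (inclPost PostA PostB M0A M0B)
      (extMark M 1 0 0) (Sum.inl t) = extMark (fire PreA PostA M t) 1 0 0 := by
  ext (p | j)
  · rfl
  · fin_cases j <;> rfl

theorem fire_inr_inl {M : P → ℕ} {t : TB} :
    fire (inclPre (SA := SA) PreA PreB) (inclPost PostA PostB M0A M0B)
      (extMark M 0 1 0) (Sum.inr (Sum.inl t)) = extMark (fire PreB PostB M t) 0 1 0 := by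
  ext (p | j)
  · rfl
  · fin_cases j <;> rfl

theorem fire_start_true :
    fire (inclPre (SA := SA) PreA PreB) (inclPost PostA PostB M0A M0B)
      (extMark (fun _ => 0) 0 0 1) (Sum.inr (Sum.inr (Sum.inl true))) = extMark M0A 1 0 0 := by
  ext (p | j)
  · simp [fire, inclPre, inclPost, extMark]
  · fin_cases j <;> rfl

theorem fire_start_false :
    fire (inclPre (SA := SA) PreA PreB) (inclPost PostA PostB M0A M0B)
      (extMark (fun _ => 0) 0 0 1) (Sum.inr (Sum.inr (Sum.inl false))) = extMark M0B 0 1 0 := by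
  ext (p | j)
  · simp [fire, inclPre, inclPost, extMark]
  · fin_cases j <;> rfl

theorem fire_letter {M : P → ℕ} {x : SA} :
    fire (inclPre PreA PreB) (inclPost PostA PostB M0A M0B)
      (extMark M 0 1 0) (Sum.inr (Sum.inr (Sum.inr x))) = extMark M 0 1 0 := by
  ext (p | j)
  · rfl
  · fin_cases j <;> rfl

theorem fires_map_inl {M M' : P → ℕ} {σ : List TA} (h : fires PreA PostA M σ M') :
    fires (inclPre (SA := SA) PreA PreB) (inclPost PostA PostB M0A M0B)
      (extMark M 1 0 0) (σ.map Sum.inl) (extMark M' 1 0 0) := by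
  induction σ generalizing M with
  | nil => cases h; rfl
  | cons t σ ih =>
    refine ⟨enabled_inl_iff.2 ⟨h.1, le_rfl⟩, ?_⟩
    rw [fire_inl]
    exact ih h.2

theorem fires_map_letter {M : P → ℕ} (w : List SA) :
    fires (inclPre PreA PreB) (inclPost PostA PostB M0A M0B)
      (extMark M 0 1 0) (w.map fun x => Sum.inr (Sum.inr (Sum.inr x))) (extMark M 0 1 0) := by
  induction w with
  | nil => rfl
  | cons x w ih =>
    refine ⟨enabled_letter_iff.2 le_rfl, ?_⟩
    rw [fire_letter]
    exact ih

theorem extMark_mem_RGs_left (lA : TA → Option SA) (lB : TB → Option SB) {M : P → ℕ}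
    {σ : List TA} (h : fires PreA PostA M0A σ M) :
    extMark M 1 0 0 ∈ RGs (inclPre PreA PreB) (inclPost PostA PostB M0A M0B)
      (extMark (fun _ => 0) 0 0 1) (inclLab lA lB) ((σ.filterMap lA).map Sum.inl) := by
  refine ⟨Sum.inr (Sum.inr (Sum.inl true)) :: σ.map Sum.inl, ?_, ?_⟩
  · rw [List.filterMap_cons_none rfl, List.filterMap_map, List.map_filterMap]
    rfl
  · refine ⟨enabled_start_iff.2 le_rfl, ?_⟩
    rw [fire_start_true]
    exact fires_map_inl h

theorem extMark_mem_RGs_right (lA : TA → Option SA) (lB : TB → Option SB) (w : List SA) :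
    extMark M0B 0 1 0 ∈ RGs (inclPre PreA PreB) (inclPost PostA PostB M0A M0B)
      (extMark (fun _ => 0) 0 0 1) (inclLab lA lB) (w.map Sum.inl) := by
  refine ⟨Sum.inr (Sum.inr (Sum.inl false)) ::
    w.map fun x => Sum.inr (Sum.inr (Sum.inr x)), ?_, ?_⟩
  · rw [List.filterMap_cons_none rfl, List.filterMap_map, ← List.filterMap_eq_map]
    rfl
  · refine ⟨enabled_start_iff.2 le_rfl, ?_⟩
    rw [fire_start_false]
    exact fires_map_letter w

theorem RG_incl_subset :
    RG (inclPre (SA := SA) PreA PreB) (inclPost PostA PostB M0A M0B)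
        (extMark (fun _ => 0) 0 0 1) ⊆
      {extMark (fun _ => 0) 0 0 1} ∪
        (fun M => extMark M 1 0 0) '' RG PreA PostA M0A ∪
        (fun M => extMark M 0 1 0) '' RG PreB PostB M0B := by
  rintro M' ⟨σ, hσ⟩
  refine fires_induction ?_ (Or.inl (Or.inl rfl)) hσ
  rintro _ ((rfl | ⟨M, hM, rfl⟩) | ⟨M, hM, rfl⟩) (t | t | b | x) ht <;> try dsimp only at ht ⊢
  · simp [enabled_inl_iff] at ht
  · simp [enabled_inr_inl_iff] at ht
  · cases b
    · rw [fire_start_false]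
      exact Or.inr ⟨M0B, ⟨[], rfl⟩, rfl⟩
    · rw [fire_start_true]
      exact Or.inl (Or.inr ⟨M0A, ⟨[], rfl⟩, rfl⟩)
  · simp [enabled_letter_iff] at ht
  · rw [fire_inl]
    exact Or.inl (Or.inr ⟨_, fire_mem_RG hM (enabled_inl_iff.1 ht).1, rfl⟩)
  · simp [enabled_inr_inl_iff] at ht
  · simp [enabled_start_iff] at ht
  · simp [enabled_letter_iff] at ht
  · simp [enabled_inl_iff] at ht
  · rw [fire_inr_inl]
    exact Or.inr ⟨_, fire_mem_RG hM (enabled_inr_inl_iff.1 ht).1, rfl⟩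
  · simp [enabled_start_iff] at ht
  · rw [fire_letter]
    exact Or.inr ⟨M, hM, rfl⟩

end inclusionNet

/-- R(A) ⊆ R(B) iff the labeled Petri net G is critically observable
w.r.t. C = {0_P×(0,0,1)} ∪ {M×(1,0,0) : M ∈ R(B)} ∪ {M×(0,1,0) : M ∈ R(B)}. -/
theorem stmt12 {P TA TB SA SB : Type*} [Finite P] [Finite TA] [Finite TB]
    [Finite SA] [Finite SB]
    (PreA PostA : P → TA → ℕ) (PreB PostB : P → TB → ℕ) (M0A M0B : P → ℕ)
    (lA : TA → Option SA) (lB : TB → Option SB) :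
    RG PreA PostA M0A ⊆ RG PreB PostB M0B ↔
      CritObsPN (inclPre PreA PreB) (inclPost PostA PostB M0A M0B)
        (extMark (fun _ => 0) 0 0 1) (inclLab lA lB)
        ({extMark (fun _ => 0) 0 0 1} ∪
          (fun M => extMark M 1 0 0) '' RG PreB PostB M0B ∪
          (fun M => extMark M 0 1 0) '' RG PreB PostB M0B) := by
  constructor
  · rintro hAB w
    refine Or.inl fun M ⟨σ, _, hσ⟩ => ?_
    exact Set.union_subset_union_left _
      (Set.union_subset_union_right _ (Set.image_mono hAB)) (RG_incl_subset ⟨σ, hσ⟩)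
  · rintro hG M ⟨σ, hσ⟩
    rcases hG ((σ.filterMap lA).map Sum.inl) with h | h
    · rcases h (extMark_mem_RGs_left lA lB hσ) with (h | ⟨M', hM', h⟩) | ⟨M', hM', h⟩
      · simp [extMark_inj] at h
      · exact (extMark_inj.1 h).1 ▸ hM'
      · simp [extMark_inj] at h
    · exact absurd (Or.inr ⟨M0B, ⟨[], rfl⟩, rfl⟩) (h (extMark_mem_RGs_right lA lB _)).2
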